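/- Let 𝒜 be a hereditary abelian category with exact structure ℰ, and 𝒞 ⊆ 𝒜 an ℰ-adapted subcategory closed under extensions. Then GS_ℰ(𝒞) is closed under extensions; consequently GS_ℰ(𝒞) is ℰ-Serre: for every ℰ-exact sequence 0 → E → F → G → 0, F ∈ GS_ℰ(𝒞) if and only if E, G ∈ GS_ℰ(𝒞). -/

import Mathlib

open CategoryTheory Limits

universe v u

variable {C : Type u} [Category.{v} C] [Abelian C]

/-- `f` is an admissible monomorphism for the class `ses` of short exact sequences:
it fits as the mono of some kernel–cokernel pair in `ses`. -/
def IsAdmMono (ses : Set (ShortComplex C)) {X Y : C} (f : X ⟶ Y) : Prop :=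
  ∃ (Z : C) (g : Y ⟶ Z) (w : f ≫ g = 0), ShortComplex.mk f g w ∈ ses

/-- `g` is an admissible epimorphism for the class `ses` of short exact sequences. -/
def IsAdmEpi (ses : Set (ShortComplex C)) {Y Z : C} (g : Y ⟶ Z) : Prop :=
  ∃ (X : C) (f : X ⟶ Y) (w : f ≫ g = 0), ShortComplex.mk f g w ∈ ses

/-- A Quillen exact structure on the abelian category `C`: a class of short exact
sequences (kernel–cokernel pairs), closed under isomorphism, containing the split
short exact sequences, with admissible monomorphisms and epimorphisms closed under
composition, and stable under pushout along arbitrary morphisms (for admissible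
monos) and pullback along arbitrary morphisms (for admissible epis). -/
structure ExactStructure (C : Type u) [Category.{v} C] [Abelian C] where
  ses : Set (ShortComplex C)
  shortExact : ∀ S ∈ ses, S.ShortExact
  iso_mem : ∀ S T : ShortComplex C, (S ≅ T) → S ∈ ses → T ∈ ses
  split_mem : ∀ S : ShortComplex C, Nonempty S.Splitting → S ∈ ses
  admMono_comp : ∀ {X Y Z : C} {f : X ⟶ Y} {g : Y ⟶ Z},
    IsAdmMono ses f → IsAdmMono ses g → IsAdmMono ses (f ≫ g)
  admEpi_comp : ∀ {X Y Z : C} {f : X ⟶ Y} {g : Y ⟶ Z},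
    IsAdmEpi ses f → IsAdmEpi ses g → IsAdmEpi ses (f ≫ g)
  admMono_pushout : ∀ {X Y D : C} (f : X ⟶ Y) (h : X ⟶ D),
    IsAdmMono ses f → IsAdmMono ses (pushout.inr f h)
  admEpi_pullback : ∀ {Y Z W : C} (g : Y ⟶ Z) (h : W ⟶ Z),
    IsAdmEpi ses g → IsAdmEpi ses (pullback.snd g h)

/-- Membership in `GS_ℰ(𝒞)`: the smallest class of objects containing `𝒞`, closed
under sums and summands, under `ℰ`-quotients (cokernels of `ℰ`-monomorphisms into
objects of the class) and under `ℰ`-subobjects (kernels of `ℰ`-epimorphisms out of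
objects of the class). -/
inductive GSmem (ℰ : ExactStructure C) (𝒞 : Set C) : C → Prop
  | base {X : C} : X ∈ 𝒞 → GSmem ℰ 𝒞 X
  | quot (S : ShortComplex C) (hS : S ∈ ℰ.ses) : GSmem ℰ 𝒞 S.X₂ → GSmem ℰ 𝒞 S.X₃
  | sub (S : ShortComplex C) (hS : S ∈ ℰ.ses) : GSmem ℰ 𝒞 S.X₂ → GSmem ℰ 𝒞 S.X₁
  | prod {X Y : C} : GSmem ℰ 𝒞 X → GSmem ℰ 𝒞 Y → GSmem ℰ 𝒞 (X ⊞ Y)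
  | smd {X Y : C} (s : Y ⟶ X) (r : X ⟶ Y) (h : s ≫ r = 𝟙 Y) : GSmem ℰ 𝒞 X → GSmem ℰ 𝒞 Y

universe w

open Abelian Pretriangulated DerivedCategory in
/-- A degree-one `Ext` class whose pullback along `i` is the class of `S` is represented by a
short exact sequence receiving a morphism from `S` over `i`. -/
theorem exists_shortExact_of_ext [HasExt.{w} C] {S : ShortComplex C} (hS : S.ShortExact)
    {D : C} (i : S.X₃ ⟶ D) (α : Ext.{w} D S.X₁ 1)
    (hα : (Ext.mk₀ i).comp α (zero_add 1) = hS.extClass) :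
    ∃ (E : C) (j : S.X₂ ⟶ E) (q : E ⟶ D) (z : (S.f ≫ j) ≫ q = 0),
      (ShortComplex.mk _ q z).ShortExact ∧ j ≫ q = S.g ≫ i := by
  let := HasDerivedCategory.standard C
  obtain ⟨Y, u, v, hT⟩ := distinguished_cocone_triangle₂ (C := DerivedCategory C)
    (X := (singleFunctor C 0).obj S.X₁) α.hom
  have hα' : hS.singleδ = (singleFunctor C 0).map i ≫ α.hom := by
    rw [← ShortComplex.ShortExact.extClass_hom hS, ← hα, Ext.comp_hom, Ext.mk₀_hom,
      ShiftedHom.mk₀_comp]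
  obtain ⟨b, hb₁, hb₂⟩ : ∃ b : (singleFunctor C 0).obj S.X₂ ⟶ Y,
      (singleFunctor C 0).map S.f ≫ b = u ∧
        b ≫ v = (singleFunctor C 0).map S.g ≫ (singleFunctor C 0).map i := by
    obtain ⟨b, hb₁, hb₂⟩ := complete_distinguished_triangle_morphism₂ hS.singleTriangle
      (Triangle.mk u v α.hom) hS.singleTriangle_distinguished hT
      (𝟙 ((singleFunctor C 0).obj S.X₁)) ((singleFunctor C 0).map i) (by
        refine Eq.trans ?_ hα'
        exact (congrArg (hS.singleδ ≫ ·) (CategoryTheory.Functor.map_id _ _)).trans (Category.comp_id _))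
    exact ⟨b, hb₁.trans (Category.id_comp u), hb₂.symm⟩
  let H := homologyFunctor C 0
  let e : singleFunctor C 0 ⋙ H ≅ 𝟭 C := singleFunctorCompHomologyFunctorIso C 0
  have hu : S.f ≫ e.inv.app S.X₂ ≫ H.map b = e.inv.app S.X₁ ≫ H.map u := by
    rw [← hb₁, H.map_comp]
    exact e.inv.naturality_assoc S.f (H.map b)
  have huv : H.map u ≫ H.map v = 0 := by
    rw [← H.map_comp]
    exact (congrArg H.map (comp_distTriang_mor_zero₁₂ _ hT)).trans (H.map_zero _ _)
  have hex : (ShortComplex.mk _ _ huv).Exact := HomologySequence.exact₂ _ hT 0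
  have hmono : Mono (H.map u) :=
    (HomologySequence.mono_homologyMap_mor₁_iff _ hT (-1) 0).2
      ((isZero_of_isGE ((singleFunctor C 0).obj D) 0 (-1) (by lia)).eq_of_src _ _)
  have hepi : Epi (H.map v) :=
    (HomologySequence.epi_homologyMap_mor₂_iff _ hT 0 1).2
      ((isZero_of_isLE ((singleFunctor C 0).obj S.X₁) 0 1 (by lia)).eq_of_tgt _ _)
  refine ⟨H.obj Y, e.inv.app S.X₂ ≫ H.map b, H.map v ≫ e.hom.app D, ?_, ?_, ?_⟩
  · rw [hu, Category.assoc, reassoc_of% huv]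
    simp
  · refine ShortComplex.shortExact_of_iso
      (S₁ := .mk _ _ huv) (ShortComplex.isoMk (e.app S.X₁) (Iso.refl _) (e.app D) ?_ ?_)
      (.mk' hex hmono hepi)
    · change e.hom.app S.X₁ ≫ S.f ≫ e.inv.app S.X₂ ≫ H.map b = H.map u ≫ 𝟙 _
      rw [hu, Category.comp_id, e.hom_inv_id_app_assoc]
    · exact Category.id_comp _
  · have h₁ := e.hom.naturality (S.g ≫ i)
    have h₂ := e.inv_hom_id_app_assoc S.X₂ (S.g ≫ i)
    rw [Category.assoc, ← H.map_comp_assoc, hb₂, ← Functor.map_comp]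
    exact (congrArg (e.inv.app S.X₂ ≫ ·) h₁).trans h₂

open Abelian in
/-- When the obstruction group `Ext² (T.X₃, S.X₁)` vanishes, an epimorphism followed by a
monomorphism can be rewritten as a monomorphism followed by an epimorphism, with the same
kernel and cokernel. -/
theorem exists_ladder [HasExt.{w} C] {S T : ShortComplex C} (hS : S.ShortExact)
    (hT : T.ShortExact) (φ : S.X₃ ⟶ T.X₁) [IsIso φ] [Subsingleton (Ext.{w} T.X₃ S.X₁ 2)] :
    ∃ (E : C) (j : S.X₂ ⟶ E) (q : E ⟶ T.X₂) (z : (S.f ≫ j) ≫ q = 0)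
      (z' : j ≫ q ≫ T.g = 0), j ≫ q = S.g ≫ φ ≫ T.f ∧
      (ShortComplex.mk _ q z).ShortExact ∧ (ShortComplex.mk j _ z').ShortExact := by
  obtain ⟨α, hα⟩ := Ext.contravariant_sequence_exact₁ hT S.X₁
    ((Ext.mk₀ (inv φ)).comp hS.extClass (zero_add 1)) (n₁ := 2) rfl (Subsingleton.elim _ _)
  obtain ⟨E, j, q, z, hE, hjq⟩ := exists_shortExact_of_ext hS (φ ≫ T.f) α (by
    rw [← Ext.mk₀_comp_mk₀_assoc, hα, Ext.mk₀_comp_mk₀_assoc]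
    simp)
  have := hS.mono_f
  have := hS.epi_g
  have := hT.mono_f
  have := hT.epi_g
  have : Mono (S.f ≫ j) := hE.mono_f
  have : Epi q := hE.epi_g
  have z' : j ≫ q ≫ T.g = 0 := by
    rw [reassoc_of% hjq, T.zero]
    simp
  refine ⟨E, j, q, z, z', hjq, hE, .mk' ?_ ?_ (inferInstanceAs (Epi (q ≫ T.g)))⟩
  · rw [ShortComplex.exact_iff_exact_up_to_refinements]
    intro A x hx
    obtain ⟨A₁, π₁, _, x₁, h₁⟩ := hT.exact.exact_up_to_refinements (x ≫ q) (by simpa using hx)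
    obtain ⟨A₂, π₂, _, x₂, h₂⟩ := surjective_up_to_refinements_of_epi (S.g ≫ φ) x₁
    obtain ⟨A₃, π₃, _, x₃, h₃⟩ := hE.exact.exact_up_to_refinements (π₂ ≫ π₁ ≫ x - x₂ ≫ j) (by
      have := π₂ ≫= h₁
      dsimp at this ⊢
      simp [this, reassoc_of% h₂, hjq])
    refine ⟨A₃, π₃ ≫ π₂ ≫ π₁, inferInstance, x₃ ≫ S.f + π₃ ≫ x₂, ?_⟩
    dsimp at h₃ ⊢
    simp only [Preadditive.comp_sub, Preadditive.add_comp, Category.assoc] at h₃ ⊢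
    rw [← h₃]
    abel
  · dsimp
    rw [Preadditive.mono_iff_cancel_zero]
    intro A x hx
    obtain ⟨A₁, π₁, _, y, hy⟩ := hS.exact.exact_up_to_refinements x (by
      rw [← cancel_mono (φ ≫ T.f), Category.assoc, ← hjq, reassoc_of% hx]
      simp)
    have hy0 : y = 0 := by
      rw [← cancel_mono (S.f ≫ j), ← reassoc_of% hy, hx]
      simp
    rw [← cancel_epi π₁, hy, hy0]
    simp

namespace CategoryTheory.ShortComplex.ShortExact

theorem exists_isPullback {S : ShortComplex C} (hS : S.ShortExact) {W : C} (h : W ⟶ S.X₃) :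
    ∃ (P : C) (a : P ⟶ S.X₂) (b : P ⟶ W) (f : S.X₁ ⟶ P) (z : f ≫ b = 0),
      IsPullback a b S.g h ∧ f ≫ a = S.f ∧ (ShortComplex.mk f b z).ShortExact := by
  have := hS.mono_f
  have := hS.epi_g
  have hf : pullback.lift S.f 0 (by simp) ≫ pullback.fst S.g h = S.f := pullback.lift_fst _ _ _
  have hb : pullback.lift S.f 0 (by simp) ≫ pullback.snd S.g h = 0 := pullback.lift_snd _ _ _
  refine ⟨pullback S.g h, pullback.fst _ _, pullback.snd _ _, pullback.lift S.f 0 (by simp), hb,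
    .of_hasPullback _ _, hf, .mk' ?_ (mono_of_mono_fac hf) ?_⟩
  swap
  · exact inferInstanceAs (Epi (pullback.snd S.g h))
  rw [ShortComplex.exact_iff_exact_up_to_refinements]
  intro A x hx
  dsimp at x hx
  obtain ⟨A₁, π, _, y, hy⟩ := hS.exact.exact_up_to_refinements (x ≫ pullback.fst _ _) (by
    rw [Category.assoc, pullback.condition, reassoc_of% hx, zero_comp])
  refine ⟨A₁, π, inferInstance, y, pullback.hom_ext ?_ ?_⟩
  · dsimp
    rw [Category.assoc, Category.assoc, hy, hf]
  · dsimp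
    rw [Category.assoc, Category.assoc, hx, hb, comp_zero, comp_zero]

theorem exists_isPushout {S : ShortComplex C} (hS : S.ShortExact) {W : C} (h : S.X₁ ⟶ W) :
    ∃ (Q : C) (a : S.X₂ ⟶ Q) (b : W ⟶ Q) (g : Q ⟶ S.X₃) (z : b ≫ g = 0),
      IsPushout S.f h a b ∧ a ≫ g = S.g ∧ (ShortComplex.mk b g z).ShortExact := by
  obtain ⟨P, a, b, f, z, hP, hf, hS'⟩ := hS.op.exists_isPullback h.op
  exact ⟨P.unop, a.unop, b.unop, f.unop, congrArg Quiver.Hom.unop z, hP.unop.flip,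
    congrArg Quiver.Hom.unop hf, hS'.unop⟩

end CategoryTheory.ShortComplex.ShortExact

theorem isPullback_biprod_map_id (W : C) {X Y : C} (g : X ⟶ Y) :
    IsPullback biprod.snd (biprod.map (𝟙 W) g) g biprod.snd where
  w := by simp
  isLimit' := ⟨PullbackCone.IsLimit.mk _ (fun s ↦ biprod.lift (s.snd ≫ biprod.fst) s.fst)
    (fun s ↦ by simp)
    (fun s ↦ by
      ext
      · simp
      · simpa using s.condition)
    (fun s m h₁ h₂ ↦ by
      ext
      · simp [← h₂]
      · simpa using h₁)⟩

theorem isPushout_biprod_map_id (W : C) {X Y : C} (f : X ⟶ Y) :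
    IsPushout f biprod.inr biprod.inr (biprod.map (𝟙 W) f) where
  w := by simp
  isColimit' := ⟨PushoutCocone.IsColimit.mk _ (fun s ↦ biprod.desc (biprod.inl ≫ s.inr) s.inl)
    (fun s ↦ by simp)
    (fun s ↦ by
      ext
      · simp
      · simpa using s.condition)
    (fun s m h₁ h₂ ↦ by
      ext
      · simp [← h₂]
      · simpa using h₁)⟩

theorem shortExact_biprod_map_id_left (W : C) {S : ShortComplex C} (hS : S.ShortExact) :
    (ShortComplex.mk (biprod.map (𝟙 W) S.f) (biprod.snd ≫ S.g) (by simp)).ShortExact := by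
  have := hS.mono_f
  have := hS.epi_g
  refine .mk' ?_ ?_ (inferInstanceAs (Epi (biprod.snd ≫ S.g)))
  · rw [ShortComplex.exact_iff_exact_up_to_refinements]
    intro A x hx
    dsimp at x hx
    obtain ⟨A₁, π, _, y, hy⟩ := hS.exact.exact_up_to_refinements (x ≫ biprod.snd) (by
      simpa using hx)
    exact ⟨A₁, π, inferInstance, biprod.lift (π ≫ x ≫ biprod.fst) y, by ext <;> simp [hy]⟩
  · exact inferInstanceAs (Mono (biprod.map (𝟙 W) S.f))

theorem shortExact_biprod_map_id_right (W : C) {S : ShortComplex C} (hS : S.ShortExact) :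
    (ShortComplex.mk (S.f ≫ biprod.inr) (biprod.map (𝟙 W) S.g) (by simp)).ShortExact := by
  have := hS.mono_f
  have := hS.epi_g
  refine .mk' ?_ (inferInstanceAs (Mono (S.f ≫ biprod.inr))) ?_
  · rw [ShortComplex.exact_iff_exact_up_to_refinements]
    intro A x hx
    dsimp at x hx
    have h₁ : x ≫ biprod.fst = 0 := by simpa using hx =≫ biprod.fst
    obtain ⟨A₁, π, _, y, hy⟩ := hS.exact.exact_up_to_refinements (x ≫ biprod.snd) (by
      simpa using hx =≫ biprod.snd)
    exact ⟨A₁, π, inferInstance, y, by ext <;> simp [hy, h₁]⟩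
  · exact inferInstanceAs (Epi (biprod.map (𝟙 W) S.g))

namespace ExactStructure

variable (ℰ : ExactStructure C)

variable {ℰ} in
theorem isAdmMono {S : ShortComplex C} (hS : S ∈ ℰ.ses) : IsAdmMono ℰ.ses S.f :=
  ⟨_, S.g, S.zero, hS⟩

variable {ℰ} in
theorem isAdmEpi {S : ShortComplex C} (hS : S ∈ ℰ.ses) : IsAdmEpi ℰ.ses S.g :=
  ⟨_, S.f, S.zero, hS⟩

variable {ℰ} in
theorem mem_of_isAdmEpi {S : ShortComplex C} (hS : S.ShortExact) (h : IsAdmEpi ℰ.ses S.g) :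
    S ∈ ℰ.ses := by
  obtain ⟨X, f, w, hf⟩ := h
  have hT := ℰ.shortExact _ hf
  have := hS.mono_f
  have : Mono f := hT.mono_f
  let e : X ≅ S.X₁ := IsLimit.conePointUniqueUpToIso hT.fIsKernel hS.fIsKernel
  have he : e.hom ≫ S.f = f :=
    IsLimit.conePointUniqueUpToIso_hom_comp hT.fIsKernel hS.fIsKernel .zero
  exact ℰ.iso_mem (.mk f S.g w) S (ShortComplex.isoMk e (Iso.refl _) (Iso.refl _) (by simp [he])
    (by simp)) hf

variable {ℰ} in
theorem mem_of_isAdmMono {S : ShortComplex C} (hS : S.ShortExact) (h : IsAdmMono ℰ.ses S.f) :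
    S ∈ ℰ.ses := by
  obtain ⟨X, g, w, hg⟩ := h
  have hT := ℰ.shortExact _ hg
  let e : X ≅ S.X₃ := IsColimit.coconePointUniqueUpToIso hT.gIsCokernel hS.gIsCokernel
  have he : g ≫ e.hom = S.g :=
    IsColimit.comp_coconePointUniqueUpToIso_hom hT.gIsCokernel hS.gIsCokernel .one
  exact ℰ.iso_mem (.mk S.f g w) S (ShortComplex.isoMk (Iso.refl _) (Iso.refl _) e (by simp)
    (by simp [he])) hg

theorem isAdmEpi_of_section {X Y : C} (g : X ⟶ Y) (s : Y ⟶ X) (h : s ≫ g = 𝟙 Y) :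
    IsAdmEpi ℰ.ses g := by
  have : Epi g := (SplitEpi.mk s h).epi
  exact ⟨_, kernel.ι g, kernel.condition g, ℰ.split_mem _ ⟨.ofExactOfSection _
    (ShortComplex.exact_kernel g) s h inferInstance⟩⟩

theorem isAdmMono_of_retraction {X Y : C} (f : X ⟶ Y) (r : Y ⟶ X) (h : f ≫ r = 𝟙 X) :
    IsAdmMono ℰ.ses f := by
  have : Mono f := (SplitMono.mk r h).mono
  exact ⟨_, cokernel.π f, cokernel.condition f, ℰ.split_mem _ ⟨.ofExactOfRetraction _
    (ShortComplex.exact_cokernel f) r h inferInstance⟩⟩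

variable {ℰ}

theorem isAdmEpi_of_isPullback {P X Y Z : C} {a : P ⟶ X} {b : P ⟶ Y} {g : X ⟶ Z} {h : Y ⟶ Z}
    (sq : IsPullback a b g h) (hg : IsAdmEpi ℰ.ses g) : IsAdmEpi ℰ.ses b := by
  rw [← sq.isoPullback_hom_snd]
  exact ℰ.admEpi_comp (ℰ.isAdmEpi_of_section _ _ sq.isoPullback.inv_hom_id)
    (ℰ.admEpi_pullback g h hg)

theorem isAdmMono_of_isPushout {X Y Z Q : C} {f : Z ⟶ X} {h : Z ⟶ Y} {a : X ⟶ Q} {b : Y ⟶ Q}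
    (sq : IsPushout f h a b) (hf : IsAdmMono ℰ.ses f) : IsAdmMono ℰ.ses b := by
  rw [← sq.inr_isoPushout_inv]
  exact ℰ.admMono_comp (ℰ.admMono_pushout f h hf)
    (ℰ.isAdmMono_of_retraction _ _ sq.isoPushout.inv_hom_id)

theorem isAdmEpi_biprod_map_id (W : C) {X Y : C} {g : X ⟶ Y} (hg : IsAdmEpi ℰ.ses g) :
    IsAdmEpi ℰ.ses (biprod.map (𝟙 W) g) :=
  isAdmEpi_of_isPullback (isPullback_biprod_map_id W g) hg

theorem isAdmMono_biprod_map_id (W : C) {X Y : C} {f : X ⟶ Y} (hf : IsAdmMono ℰ.ses f) :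
    IsAdmMono ℰ.ses (biprod.map (𝟙 W) f) :=
  isAdmMono_of_isPushout (isPushout_biprod_map_id W f) hf

/-- If a composite is an admissible epimorphism, so is its second factor. -/
theorem isAdmEpi_of_comp {X Y Z : C} {f : X ⟶ Y} {g : Y ⟶ Z} (h : IsAdmEpi ℰ.ses (f ≫ g)) :
    IsAdmEpi ℰ.ses g := by
  have : Epi (f ≫ g) := by
    obtain ⟨_, _, _, h⟩ := h
    exact (ℰ.shortExact _ h).epi_g
  have : Epi g := epi_of_epi f g
  have hS : (ShortComplex.mk _ _ (kernel.condition g)).ShortExact :=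
    .mk' (ShortComplex.exact_kernel g) inferInstance inferInstance
  have hsnd : IsAdmEpi ℰ.ses (biprod.snd ≫ g : X ⊞ Y ⟶ Z) := by
    have fac : (biprod.snd ≫ g : X ⊞ Y ⟶ Z) =
        biprod.lift (biprod.snd - biprod.fst ≫ f) biprod.fst ≫
          biprod.map (𝟙 Y) (f ≫ g) ≫ biprod.desc g (𝟙 Z) := by
      have : biprod.map (𝟙 Y) (f ≫ g) ≫ biprod.desc g (𝟙 Z) = biprod.desc g (f ≫ g) := by
        ext <;> simp
      rw [this, biprod.lift_desc]
      simp
    rw [fac]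
    exact ℰ.admEpi_comp
      (ℰ.isAdmEpi_of_section _ (biprod.lift biprod.snd (biprod.fst + biprod.snd ≫ f))
        (by ext <;> simp))
      (ℰ.admEpi_comp (isAdmEpi_biprod_map_id Y h)
        (ℰ.isAdmEpi_of_section _ biprod.inr (by simp)))
  have hmap := isAdmMono (mem_of_isAdmEpi (shortExact_biprod_map_id_left X hS) hsnd)
  refine isAdmEpi (mem_of_isAdmMono hS (isAdmMono_of_isPushout (a := biprod.snd)
    (h := biprod.snd) ?_ hmap))
  exact {
    w := by simp
    isColimit' := ⟨PushoutCocone.IsColimit.mk _ (fun s ↦ biprod.inr ≫ s.inl)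
      (fun s ↦ by
        have := biprod.inl ≫= s.condition
        ext
        · simpa using this.symm
        · simp)
      (fun s ↦ by simpa using biprod.inr ≫= s.condition)
      (fun s m h₁ h₂ ↦ by simp [← h₁])⟩ }

/-- If a composite is an admissible monomorphism, so is its first factor. -/
theorem isAdmMono_of_comp {X Y Z : C} {f : X ⟶ Y} {g : Y ⟶ Z} (h : IsAdmMono ℰ.ses (f ≫ g)) :
    IsAdmMono ℰ.ses f := by
  have : Mono (f ≫ g) := by
    obtain ⟨_, _, _, h⟩ := h
    exact (ℰ.shortExact _ h).mono_f
  have : Mono f := mono_of_mono f g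
  have hS : (ShortComplex.mk _ _ (cokernel.condition f)).ShortExact :=
    .mk' (ShortComplex.exact_cokernel f) inferInstance inferInstance
  have hinr : IsAdmMono ℰ.ses (f ≫ biprod.inr : X ⟶ Z ⊞ Y) := by
    have fac : (f ≫ biprod.inr : X ⟶ Z ⊞ Y) =
        (biprod.lift f (𝟙 X) ≫ biprod.map (𝟙 Y) (f ≫ g)) ≫
          biprod.lift (biprod.snd - biprod.fst ≫ g) biprod.fst := by
      ext <;> simp
    rw [fac]
    exact ℰ.admMono_comp
      (ℰ.admMono_comp (ℰ.isAdmMono_of_retraction _ biprod.snd (by simp))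
        (isAdmMono_biprod_map_id Y h))
      (ℰ.isAdmMono_of_retraction _ (biprod.lift biprod.snd (biprod.fst + biprod.snd ≫ g))
        (by ext <;> simp))
  have hmap := isAdmEpi (mem_of_isAdmMono (shortExact_biprod_map_id_right Z hS) hinr)
  refine isAdmMono (mem_of_isAdmEpi hS (isAdmEpi_of_isPullback (a := biprod.inr)
    (h := biprod.inr) ?_ hmap))
  exact {
    w := by simp
    isLimit' := ⟨PullbackCone.IsLimit.mk _ (fun s ↦ s.fst ≫ biprod.snd)
      (fun s ↦ by
        have := s.condition =≫ biprod.fst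
        ext
        · simpa using this.symm
        · simp)
      (fun s ↦ by simpa using s.condition =≫ biprod.snd)
      (fun s m h₁ h₂ ↦ by simp [← h₁])⟩ }

end ExactStructure

/-- The closure of `𝒞` under `ℰ`-quotients and `ℰ`-subobjects alone. -/
inductive SubquotClosure (ℰ : ExactStructure C) (𝒞 : Set C) : C → Prop
  | base {X : C} : X ∈ 𝒞 → SubquotClosure ℰ 𝒞 X
  | quot (S : ShortComplex C) (hS : S ∈ ℰ.ses) :
      SubquotClosure ℰ 𝒞 S.X₂ → SubquotClosure ℰ 𝒞 S.X₃
  | sub (S : ShortComplex C) (hS : S ∈ ℰ.ses) :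
      SubquotClosure ℰ 𝒞 S.X₂ → SubquotClosure ℰ 𝒞 S.X₁

namespace SubquotClosure

variable {ℰ : ExactStructure C} {𝒞 : Set C}

theorem of_isAdmEpi {X Y : C} {g : X ⟶ Y} (hg : IsAdmEpi ℰ.ses g)
    (hX : SubquotClosure ℰ 𝒞 X) : SubquotClosure ℰ 𝒞 Y := by
  obtain ⟨_, _, _, h⟩ := hg
  exact quot _ h hX

theorem of_isAdmMono {X Y : C} {f : X ⟶ Y} (hf : IsAdmMono ℰ.ses f)
    (hY : SubquotClosure ℰ 𝒞 Y) : SubquotClosure ℰ 𝒞 X := by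
  obtain ⟨_, _, _, h⟩ := hf
  exact sub _ h hY

theorem of_retract {X Y : C} (s : Y ⟶ X) (r : X ⟶ Y) (h : s ≫ r = 𝟙 Y)
    (hX : SubquotClosure ℰ 𝒞 X) : SubquotClosure ℰ 𝒞 Y :=
  of_isAdmMono (ℰ.isAdmMono_of_retraction s r h) hX

theorem biprod_of_forall_mem {W X : C} (h : ∀ Y ∈ 𝒞, SubquotClosure ℰ 𝒞 (W ⊞ Y))
    (hX : SubquotClosure ℰ 𝒞 X) : SubquotClosure ℰ 𝒞 (W ⊞ X) := by
  induction hX with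
  | base hX => exact h _ hX
  | quot S hS _ ih =>
    exact of_isAdmEpi (ExactStructure.isAdmEpi_biprod_map_id W (ExactStructure.isAdmEpi hS)) ih
  | sub S hS _ ih =>
    exact of_isAdmMono (ExactStructure.isAdmMono_biprod_map_id W (ExactStructure.isAdmMono hS)) ih

theorem biprod_mem (h : ∀ X ∈ 𝒞, ∀ Y ∈ 𝒞, (X ⊞ Y) ∈ 𝒞) {X Y : C}
    (hX : SubquotClosure ℰ 𝒞 X) (hY : SubquotClosure ℰ 𝒞 Y) :
    SubquotClosure ℰ 𝒞 (X ⊞ Y) := by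
  refine biprod_of_forall_mem (fun Y hY ↦ ?_) hY
  exact of_retract _ _ (biprod.braiding X Y).hom_inv_id
    (biprod_of_forall_mem (fun X hX ↦ base (h _ hY _ hX)) hX)

theorem of_gsmem (h : ∀ X ∈ 𝒞, ∀ Y ∈ 𝒞, (X ⊞ Y) ∈ 𝒞) {X : C} (hX : GSmem ℰ 𝒞 X) :
    SubquotClosure ℰ 𝒞 X := by
  induction hX with
  | base hX => exact base hX
  | quot S hS _ ih => exact quot S hS ih
  | sub S hS _ ih => exact sub S hS ih
  | prod _ _ ihX ihY => exact biprod_mem h ihX ihY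
  | smd s r h _ ih => exact of_retract s r h ih

theorem gsmem {X : C} (hX : SubquotClosure ℰ 𝒞 X) : GSmem ℰ 𝒞 X := by
  induction hX with
  | base hX => exact .base hX
  | quot S hS _ ih => exact .quot S hS ih
  | sub S hS _ ih => exact .sub S hS ih

end SubquotClosure

/-- Every extension of `Y` by `X` is `ℰ`-exact with middle term in `SubquotClosure ℰ 𝒞`. -/
def ExtensionsAdmissible (ℰ : ExactStructure C) (𝒞 : Set C) (X Y : C) : Prop :=
  ∀ ⦃Z : C⦄ (f : X ⟶ Z) (g : Z ⟶ Y) (w : f ≫ g = 0), (ShortComplex.mk f g w).ShortExact →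
    ShortComplex.mk f g w ∈ ℰ.ses ∧ SubquotClosure ℰ 𝒞 Z

namespace ExtensionsAdmissible

open ExactStructure

variable {ℰ : ExactStructure C} {𝒞 : Set C} {X Y : C} {S : ShortComplex C}

theorem quot_right (hS : S ∈ ℰ.ses) (h : ExtensionsAdmissible ℰ 𝒞 X S.X₂) :
    ExtensionsAdmissible ℰ 𝒞 X S.X₃ := by
  intro Z f g w hZ
  obtain ⟨P, a, b, f', z, sq, -, hP⟩ := hZ.exists_isPullback S.g
  obtain ⟨hPmem, hP'⟩ := h f' b z hP
  have hb : IsAdmEpi ℰ.ses (a ≫ g) := by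
    rw [show a ≫ g = b ≫ S.g from sq.w]
    exact ℰ.admEpi_comp (isAdmEpi hPmem) (isAdmEpi hS)
  exact ⟨mem_of_isAdmEpi hZ (isAdmEpi_of_comp hb),
    hP'.of_isAdmEpi (isAdmEpi_of_isPullback sq.flip (isAdmEpi hS))⟩

theorem sub_left (hS : S ∈ ℰ.ses) (h : ExtensionsAdmissible ℰ 𝒞 S.X₂ Y) :
    ExtensionsAdmissible ℰ 𝒞 S.X₁ Y := by
  intro Z f g w hZ
  obtain ⟨Q, a, b, g', z, sq, -, hQ⟩ := hZ.exists_isPushout S.f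
  obtain ⟨hQmem, hQ'⟩ := h b g' z hQ
  have hb : IsAdmMono ℰ.ses (f ≫ a) := by
    rw [show f ≫ a = S.f ≫ b from sq.w]
    exact ℰ.admMono_comp (isAdmMono hS) (isAdmMono hQmem)
  exact ⟨mem_of_isAdmMono hZ (isAdmMono_of_comp hb),
    hQ'.of_isAdmMono (isAdmMono_of_isPushout sq.flip (isAdmMono hS))⟩

open Abelian in
theorem sub_right [HasExt.{w} C] [Subsingleton (Ext.{w} S.X₃ X 2)] (hS : S ∈ ℰ.ses)
    (h : ExtensionsAdmissible ℰ 𝒞 X S.X₂) : ExtensionsAdmissible ℰ 𝒞 X S.X₁ := by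
  intro Z f g w hZ
  obtain ⟨E, j, q, z, z', -, hE, hj⟩ := exists_ladder hZ (ℰ.shortExact _ hS) (𝟙 S.X₁)
  obtain ⟨hEmem, hE'⟩ := h _ q z hE
  exact ⟨mem_of_isAdmMono hZ (isAdmMono_of_comp (isAdmMono hEmem)),
    .sub _ (mem_of_isAdmEpi hj (ℰ.admEpi_comp (isAdmEpi hEmem) (isAdmEpi hS))) hE'⟩

open Abelian in
theorem quot_left [HasExt.{w} C] [Subsingleton (Ext.{w} Y S.X₁ 2)] (hS : S ∈ ℰ.ses)
    (h : ExtensionsAdmissible ℰ 𝒞 S.X₂ Y) : ExtensionsAdmissible ℰ 𝒞 S.X₃ Y := by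
  intro Z f g w hZ
  obtain ⟨E, j, q, z, z', -, hq, hE⟩ := exists_ladder (ℰ.shortExact _ hS) hZ (𝟙 S.X₃)
  obtain ⟨hEmem, hE'⟩ := h j _ z' hE
  exact ⟨mem_of_isAdmEpi hZ (isAdmEpi_of_comp (isAdmEpi hEmem)),
    .quot _ (mem_of_isAdmMono hq (ℰ.admMono_comp (isAdmMono hS) (isAdmMono hEmem))) hE'⟩

open Abelian in
theorem of_subquotClosure [HasExt.{w} C] (hereditary : ∀ X Y : C, Subsingleton (Ext.{w} X Y 2))
    (h : ∀ X ∈ 𝒞, ∀ Y ∈ 𝒞, ExtensionsAdmissible ℰ 𝒞 X Y)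
    (hX : SubquotClosure ℰ 𝒞 X) (hY : SubquotClosure ℰ 𝒞 Y) :
    ExtensionsAdmissible ℰ 𝒞 X Y := by
  induction hX with
  | base hX =>
    induction hY with
    | base hY => exact h _ hX _ hY
    | quot S hS _ ih => exact quot_right hS ih
    | sub S hS _ ih => exact sub_right hS ih
  | quot S hS _ ih => exact quot_left hS ih
  | sub S hS _ ih => exact sub_left hS ih

end ExtensionsAdmissible

open Abelian in
/-- let `𝒜` be a hereditary abelian category with exact structure `ℰ`
and `𝒞 ⊆ 𝒜` an `ℰ`-adapted subcategory closed under extensions.  Then `GS_ℰ(𝒞)` is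
closed under extensions; consequently `GS_ℰ(𝒞)` is `ℰ`-Serre: for every `ℰ`-exact
sequence `0 → E → F → G → 0`, `F ∈ GS_ℰ(𝒞)` iff both `E, G ∈ GS_ℰ(𝒞)`. -/
theorem GS_extension_closed_and_ESerre [HasExt.{w} C] (ℰ : ExactStructure C)
    (hereditary : ∀ X Y : C, Subsingleton (Ext.{w} X Y 2))
    (𝒞 : Set C)
    (hadapted : ∀ S : ShortComplex C, S.ShortExact → S.X₃ ∈ 𝒞 → S.X₁ ∈ 𝒞 → S ∈ ℰ.ses)
    (hextclosed : ∀ S : ShortComplex C, S.ShortExact → S.X₁ ∈ 𝒞 → S.X₃ ∈ 𝒞 → S.X₂ ∈ 𝒞) :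
    (∀ S : ShortComplex C, S.ShortExact →
        GSmem ℰ 𝒞 S.X₁ → GSmem ℰ 𝒞 S.X₃ → GSmem ℰ 𝒞 S.X₂) ∧
    (∀ S ∈ ℰ.ses, (GSmem ℰ 𝒞 S.X₂ ↔ GSmem ℰ 𝒞 S.X₁ ∧ GSmem ℰ 𝒞 S.X₃)) := by
  have hmem : ∀ X ∈ 𝒞, ∀ Y ∈ 𝒞, ExtensionsAdmissible ℰ 𝒞 X Y := fun X hX Y hY Z f g w hZ ↦
    ⟨hadapted _ hZ hY hX, .base (hextclosed _ hZ hX hY)⟩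
  have hsum : ∀ X ∈ 𝒞, ∀ Y ∈ 𝒞, (X ⊞ Y) ∈ 𝒞 := fun X hX Y hY ↦
    hextclosed (.mk (biprod.inl : X ⟶ X ⊞ Y) biprod.snd (by simp))
      (ShortComplex.Splitting.ofHasBinaryBiproduct X Y).shortExact hX hY
  have hext : ∀ S : ShortComplex C, S.ShortExact →
      GSmem ℰ 𝒞 S.X₁ → GSmem ℰ 𝒞 S.X₃ → GSmem ℰ 𝒞 S.X₂ := fun S hS h₁ h₃ ↦
    (ExtensionsAdmissible.of_subquotClosure hereditary hmem (.of_gsmem hsum h₁)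
      (.of_gsmem hsum h₃) S.f S.g S.zero hS).2.gsmem
  exact ⟨hext, fun S hS ↦ ⟨fun h ↦ ⟨.sub S hS h, .quot S hS h⟩,
    fun h ↦ hext S (ℰ.shortExact S hS) h.1 h.2⟩⟩
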